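/- arXiv:2406.18290 — 5 statements merged into one kernel-verified Lean document; each statement's English description precedes it below -/
import Mathlib

section
/- Let b > 0 and 𝓗 > 0, and set T₀ = (1/b)·arctan(b/𝓗). Suppose u : [0, T] → ℝ is differentiable and satisfies the Riccati differential inequality u'(t) + u(t)² + b² ≥ 0 for all t ∈ [0, T], together with u(0) ≥ −𝓗. Then for every t ∈ [0, min(T, T₀)) one has u(t) ≥ −(b²·tan(bt) + b𝓗)/(b − 𝓗·tan(bt)). -/
/-- Riccati comparison. If `b > 0`, `𝓗 > 0`, `T₀ = (1/b)·arctan(b/𝓗)`, and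
`u : [0,T] → ℝ` is differentiable with `u'(t) + u(t)² + b² ≥ 0` on `[0,T]` and
`u(0) ≥ -𝓗`, then `u(t) ≥ -(b²·tan(bt) + b𝓗)/(b - 𝓗·tan(bt))` for all
`t ∈ [0, min(T, T₀))`. -/
theorem riccati_comparison_tan (b H T T₀ : ℝ) (hb : 0 < b) (hH : 0 < H)
    (hT₀ : T₀ = (1 / b) * Real.arctan (b / H))
    (u u' : ℝ → ℝ)
    (hderiv : ∀ t ∈ Set.Icc 0 T, HasDerivWithinAt u (u' t) (Set.Icc 0 T) t)
    (hineq : ∀ t ∈ Set.Icc 0 T, u' t + (u t) ^ 2 + b ^ 2 ≥ 0)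
    (h0 : u 0 ≥ -H) :
    ∀ t ∈ Set.Ico 0 (min T T₀),
      u t ≥ -(b ^ 2 * Real.tan (b * t) + b * H) / (b - H * Real.tan (b * t)) := by
  intro s hs
  obtain ⟨hs0, hs1⟩ := hs
  have hsT : s < T := lt_of_lt_of_le hs1 (min_le_left _ _)
  have hsT0 : s < T₀ := lt_of_lt_of_le hs1 (min_le_right _ _)
  have hT0 : (0 : ℝ) ≤ T := hs0.trans hsT.le
  have hcos : ∀ x ∈ Set.Icc 0 s, 0 < Real.cos (b * x) ∧ H * Real.tan (b * x) < b := by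
    intro x hx
    have h1 : b * x < Real.arctan (b / H) := by
      have h2 : x < (1 / b) * Real.arctan (b / H) := by
        rw [← hT₀]
        exact lt_of_le_of_lt hx.2 hsT0
      have h3 := mul_lt_mul_of_pos_left h2 hb
      have h4 : b * ((1 / b) * Real.arctan (b / H)) = Real.arctan (b / H) := by
        field_simp
      rwa [h4] at h3
    have h5 := Real.arctan_lt_pi_div_two (b / H)
    have h6 : 0 ≤ b * x := mul_nonneg hb.le hx.1
    have h7 : -(Real.pi / 2) < b * x := by linarith [Real.pi_pos]
    refine ⟨Real.cos_pos_of_mem_Ioo ⟨h7, by linarith⟩, ?_⟩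
    have h8 := Real.tan_lt_tan_of_lt_of_lt_pi_div_two h7 h5 h1
    rw [Real.tan_arctan, lt_div_iff₀ hH] at h8
    linarith
  have hypos : ∀ x ∈ Set.Icc 0 s, 0 < b * Real.cos (b * x) - H * Real.sin (b * x) := by
    intro x hx
    obtain ⟨h1, h2⟩ := hcos x hx
    have h3 := mul_lt_mul_of_pos_right h2 h1
    rw [mul_assoc, Real.tan_mul_cos h1.ne'] at h3
    linarith
  have hucont : ContinuousOn u (Set.Icc 0 T) := fun t ht => (hderiv t ht).continuousWithinAt
  set v : ℝ → ℝ := Set.IccExtend hT0 ((Set.Icc 0 T).restrict u) with hv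
  have hvcont : Continuous v := (continuousOn_iff_continuous_restrict.1 hucont).Icc_extend'
  have hvu : ∀ x ∈ Set.Icc 0 T, v x = u x := fun x hx => by
    rw [hv, Set.IccExtend_of_mem hT0 _ hx]; rfl
  set U : ℝ → ℝ := fun x => ∫ r in (0 : ℝ)..x, v r with hU
  have hUd : ∀ x, HasDerivAt U (v x) x := fun x => hvcont.integral_hasStrictDerivAt 0 x |>.hasDerivAt
  set w : ℝ → ℝ := fun x => u x * (b * Real.cos (b * x) - H * Real.sin (b * x))
    + (b ^ 2 * Real.sin (b * x) + b * H * Real.cos (b * x)) with hw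
  have hUcont : Continuous U := continuous_iff_continuousAt.2 fun x => (hUd x).continuousAt
  have hmono : MonotoneOn (fun x => Real.exp (U x) * w x) (Set.Icc 0 s) := by
    have hsub : Set.Icc 0 s ⊆ Set.Icc 0 T := Set.Icc_subset_Icc_right hsT.le
    have hus := hucont.mono hsub
    have hd : ∀ x ∈ Set.Ioo 0 s, HasDerivAt (fun x => Real.exp (U x) * w x)
        (Real.exp (U x) * ((u' x + u x ^ 2 + b ^ 2) *
          (b * Real.cos (b * x) - H * Real.sin (b * x)))) x := by
      intro x hx
      have hxT : x ∈ Set.Icc 0 T := hsub ⟨hx.1.le, hx.2.le⟩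
      have hu := (hderiv x hxT).hasDerivAt (Icc_mem_nhds hx.1 (hx.2.trans hsT))
      have hl : HasDerivAt (fun x : ℝ => b * x) b x := by
        simpa using (hasDerivAt_id x).const_mul b
      have hc := hl.cos
      have hsn := hl.sin
      have h := (hUd x).exp.mul ((hu.mul ((hc.const_mul b).sub (hsn.const_mul H))).add
        ((hsn.const_mul (b ^ 2)).add (hc.const_mul (b * H))))
      refine h.congr_deriv ?_
      rw [hvu x hxT]
      simp only [Pi.add_apply, Pi.mul_apply, Pi.sub_apply]
      ring
    refine monotoneOn_of_deriv_nonneg (convex_Icc 0 s) ?_ ?_ ?_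
    · rw [hw]
      fun_prop
    · rw [interior_Icc]
      exact fun x hx => (hd x hx).differentiableAt.differentiableWithinAt
    · rw [interior_Icc]
      intro x hx
      rw [(hd x hx).deriv]
      have hx' : x ∈ Set.Icc 0 s := ⟨hx.1.le, hx.2.le⟩
      exact mul_nonneg (Real.exp_pos _).le (mul_nonneg (hineq x (hsub hx')) (hypos x hx').le)
  have hs' : s ∈ Set.Icc 0 s := ⟨hs0, le_rfl⟩
  have hm := hmono ⟨le_rfl, hs0⟩ hs' hs0
  have hw0 : 0 ≤ w 0 := by
    simp only [hw, mul_zero, Real.cos_zero, Real.sin_zero]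
    nlinarith
  have hws : 0 ≤ w s := by
    have h1 : 0 ≤ Real.exp (U s) * w s := le_trans (mul_nonneg (Real.exp_pos _).le hw0) hm
    exact nonneg_of_mul_nonneg_right h1 (Real.exp_pos _)
  obtain ⟨hc, ht⟩ := hcos s hs'
  rw [ge_iff_le, div_le_iff₀ (by linarith)]
  have key : w s = (u s * (b - H * Real.tan (b * s)) + (b ^ 2 * Real.tan (b * s) + b * H))
      * Real.cos (b * s) := by
    have h1 := Real.tan_mul_cos hc.ne'
    simp only [hw]
    rw [← h1]
    ring
  rw [key] at hws
  have := nonneg_of_mul_nonneg_left hws hc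
  linarith
end

section
/- Let 𝓗 > 0. Suppose u : [0, T] → ℝ is differentiable and satisfies the Riccati differential inequality u'(t) + u(t)² ≥ 0 for all t ∈ [0, T], together with u(0) ≥ −𝓗. Then for every t ∈ [0, min(T, 1/𝓗)) one has u(t) ≥ −𝓗/(1 − 𝓗t). -/
/-- Riccati comparison, flat case. If `𝓗 > 0` and `u : [0,T] → ℝ` is
differentiable with `u'(t) + u(t)² ≥ 0` on `[0,T]` and `u(0) ≥ -𝓗`, then
`u(t) ≥ -𝓗/(1 - 𝓗t)` for all `t ∈ [0, min(T, 1/𝓗))`. -/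
theorem riccati_comparison_flat (H T : ℝ) (hH : 0 < H)
    (u u' : ℝ → ℝ)
    (hderiv : ∀ t ∈ Set.Icc 0 T, HasDerivWithinAt u (u' t) (Set.Icc 0 T) t)
    (hineq : ∀ t ∈ Set.Icc 0 T, u' t + (u t) ^ 2 ≥ 0)
    (h0 : u 0 ≥ -H) :
    ∀ t ∈ Set.Ico 0 (min T (1 / H)), u t ≥ -H / (1 - H * t) := by
  intro t ht
  have ht0 : 0 ≤ t := ht.1
  have htT : t < T := lt_of_lt_of_le ht.2 (min_le_left _ _)
  have htH : t < 1 / H := lt_of_lt_of_le ht.2 (min_le_right _ _)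
  have hpos : ∀ s ≤ t, 0 < 1 - H * s := by
    intro s hs
    have h1 : s < 1 / H := lt_of_le_of_lt hs htH
    rw [lt_div_iff₀ hH] at h1
    linarith
  have hT : (0 : ℝ) ≤ T := ht0.trans htT.le
  have hcont : ContinuousOn u (Set.Icc 0 T) := fun s hs => (hderiv s hs).continuousWithinAt
  obtain ⟨c, hc, hcu⟩ : ∃ c : ℝ → ℝ, Continuous c ∧ ∀ s ∈ Set.Icc 0 T, c s = u s :=
    ⟨Set.IccExtend hT ((Set.Icc 0 T).restrict u),
      (continuousOn_iff_continuous_restrict.mp hcont).Icc_extend',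
      fun s hs => by rw [Set.IccExtend_of_mem hT _ hs]; rfl⟩
  have hU : ∀ s, HasDerivAt (fun x => ∫ y in (0 : ℝ)..x, c y) (c s) s := fun s =>
    intervalIntegral.integral_hasDerivAt_right (hc.intervalIntegrable _ _)
      (hc.stronglyMeasurableAtFilter _ _) hc.continuousAt
  have hsub : Set.Icc 0 t ⊆ Set.Icc 0 T := Set.Icc_subset_Icc le_rfl htT.le
  have hg : ∀ s ∈ Set.Icc 0 t, HasDerivWithinAt
      (fun x => ((1 - H * x) * u x + H) * Real.exp (∫ y in (0 : ℝ)..x, c y))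
      ((1 - H * s) * (u' s + (u s) ^ 2) * Real.exp (∫ y in (0 : ℝ)..s, c y))
      (Set.Icc 0 t) s := by
    intro s hs
    have h1 := (hderiv s (hsub hs)).mono hsub
    have h2 : HasDerivWithinAt (fun x : ℝ => 1 - H * x) (-(H * 1)) (Set.Icc 0 t) s :=
      (((hasDerivAt_id s).const_mul H).const_sub 1).hasDerivWithinAt
    have h3 := ((h2.mul h1).add_const H).mul (hU s).exp.hasDerivWithinAt
    refine h3.congr_deriv ?_
    simp only [Pi.mul_apply, hcu s (hsub hs)]
    ring
  have hmono := monotoneOn_of_hasDerivWithinAt_nonneg (convex_Icc 0 t)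
    (fun s hs => (hg s hs).continuousWithinAt)
    (fun s hs => (hg s (interior_subset hs)).mono interior_subset)
    (fun s hs => by
      have hs' := interior_subset hs
      exact mul_nonneg (mul_nonneg (hpos s hs'.2).le (hineq s (hsub hs'))) (Real.exp_pos _).le)
  have h := hmono (Set.left_mem_Icc.mpr ht0) (Set.right_mem_Icc.mpr ht0) ht0
  simp only [mul_zero, sub_zero, one_mul, intervalIntegral.integral_same, Real.exp_zero,
    mul_one] at h
  have h4 : 0 ≤ (1 - H * t) * u t + H :=
    nonneg_of_mul_nonneg_left (le_trans (by linarith) h) (Real.exp_pos _)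
  rw [ge_iff_le, div_le_iff₀ (hpos t le_rfl)]
  linarith
end

section
/- Let 0 < α < κ and set T₀ = (1/α)·arctanh(α/κ). Suppose u : [0, T] → ℝ is differentiable and satisfies the Riccati differential inequality u'(t) + u(t)² − α² ≥ 0 for all t ∈ [0, T], together with u(0) ≥ −κ. Then for every t ∈ [0, min(T, T₀)) one has u(t) ≥ −(κα − α²·tanh(αt))/(α − κ·tanh(αt)). -/
/-- The real inverse hyperbolic tangent, `arctanh x = (1/2)·log((1+x)/(1-x))`. -/
noncomputable def arctanh (x : ℝ) : ℝ := (1 / 2) * Real.log ((1 + x) / (1 - x))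

/-- Riccati comparison, hyperbolic case. If `0 < α < κ`,
`T₀ = (1/α)·arctanh(α/κ)`, and `u : [0,T] → ℝ` is differentiable with
`u'(t) + u(t)² - α² ≥ 0` on `[0,T]` and `u(0) ≥ -κ`, then
`u(t) ≥ -(κα - α²·tanh(αt))/(α - κ·tanh(αt))` for all `t ∈ [0, min(T, T₀))`. -/
theorem riccati_comparison_tanh (α κ T T₀ : ℝ) (hα : 0 < α) (hκ : α < κ)
    (hT₀ : T₀ = (1 / α) * arctanh (α / κ))
    (u u' : ℝ → ℝ)
    (hderiv : ∀ t ∈ Set.Icc 0 T, HasDerivWithinAt u (u' t) (Set.Icc 0 T) t)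
    (hineq : ∀ t ∈ Set.Icc 0 T, u' t + (u t) ^ 2 - α ^ 2 ≥ 0)
    (h0 : u 0 ≥ -κ) :
    ∀ t ∈ Set.Ico 0 (min T T₀),
      u t ≥ -(κ * α - α ^ 2 * Real.tanh (α * t)) / (α - κ * Real.tanh (α * t)) := by
  intro t ht
  obtain ⟨ht0, htm⟩ := ht
  have htT : t < T := lt_of_lt_of_le htm (min_le_left _ _)
  have htT₀ : t < T₀ := lt_of_lt_of_le htm (min_le_right _ _)
  have hT : (0 : ℝ) ≤ T := ht0.trans htT.le
  have hphi : ∀ s, s < T₀ → 0 < α * Real.cosh (α * s) - κ * Real.sinh (α * s) := by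
    intro s hs
    have hκ0 : 0 < κ := hα.trans hκ
    have hd : 0 < κ - α := sub_pos.2 hκ
    have h1 : 2 * (α * s) < Real.log ((κ + α) / (κ - α)) := by
      have e : (1 + α / κ) / (1 - α / κ) = (κ + α) / (κ - α) := by
        have : 1 - α / κ = (κ - α) / κ := by field_simp
        rw [this]
        field_simp
      rw [hT₀, arctanh, e, one_div, lt_inv_mul_iff₀ hα] at hs
      linarith
    rw [Real.lt_log_iff_exp_lt (by positivity), lt_div_iff₀ hd, two_mul, Real.exp_add] at h1
    rw [Real.cosh_eq, Real.sinh_eq, Real.exp_neg]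
    have he := Real.exp_pos (α * s)
    set e := Real.exp (α * s)
    have : α * ((e + e⁻¹) / 2) - κ * ((e - e⁻¹) / 2)
        = ((κ + α) - e * e * (κ - α)) / (2 * e) := by
      field_simp
      ring
    rw [this]
    exact div_pos (by linarith) (by positivity)
  have hcont : ContinuousOn u (Set.Icc 0 T) := fun s hs => (hderiv s hs).continuousWithinAt
  obtain ⟨v, hv, hvu⟩ : ∃ v : ℝ → ℝ, Continuous v ∧ ∀ s ∈ Set.Icc 0 T, v s = u s := by
    refine ⟨Set.IccExtend hT ((Set.Icc 0 T).restrict u), ?_, ?_⟩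
    · exact (continuousOn_iff_continuous_restrict.1 hcont).Icc_extend'
    · intro s hs
      rw [Set.IccExtend_of_mem _ _ hs]
      rfl
  have hU : ∀ s, HasDerivAt (fun s => ∫ x in (0 : ℝ)..s, v x) (v s) s := fun s =>
    intervalIntegral.integral_hasDerivAt_right (hv.intervalIntegrable _ _)
      (hv.stronglyMeasurableAtFilter _ _) hv.continuousAt
  set U : ℝ → ℝ := fun s => ∫ x in (0 : ℝ)..s, v x with hUdef
  let G : ℝ → ℝ := fun s => Real.exp (U s) *
    (u s * (α * Real.cosh (α * s) - κ * Real.sinh (α * s))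
      - (α * (α * Real.sinh (α * s)) - κ * (α * Real.cosh (α * s))))
  have hG : ∀ s ∈ Set.Icc 0 T, HasDerivWithinAt G (Real.exp (U s) *
      ((α * Real.cosh (α * s) - κ * Real.sinh (α * s)) * (u' s + u s ^ 2 - α ^ 2)))
      (Set.Icc 0 T) s := by
    intro s hs
    have hl : HasDerivAt (fun s : ℝ => α * s) α s := by
      simpa using (hasDerivAt_id s).const_mul α
    have hc := (hl.cosh).hasDerivWithinAt (s := Set.Icc 0 T)
    have hsn := (hl.sinh).hasDerivWithinAt (s := Set.Icc 0 T)
    have hE := ((hU s).exp).hasDerivWithinAt (s := Set.Icc 0 T)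
    have := hE.mul (((hderiv s hs).mul ((hc.const_mul α).sub (hsn.const_mul κ))).sub
      (((hsn.const_mul α).const_mul α).sub ((hc.const_mul α).const_mul κ)))
    refine this.congr_deriv ?_
    simp only [Pi.mul_apply, Pi.sub_apply]
    rw [hvu s hs]
    ring
  have hsub : Set.Icc 0 t ⊆ Set.Icc 0 T := Set.Icc_subset_Icc_right htT.le
  have hmono : MonotoneOn G (Set.Icc 0 t) := by
    refine monotoneOn_of_hasDerivWithinAt_nonneg (convex_Icc 0 t)
      (fun s hs => ((hG s (hsub hs)).mono hsub).continuousWithinAt)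
      (fun s hs => (hG s (hsub (interior_subset hs))).mono (interior_subset.trans hsub)) ?_
    intro s hs
    have hs' := interior_subset hs
    exact mul_nonneg (Real.exp_pos _).le
      (mul_nonneg (hphi s (hs'.2.trans_lt htT₀)).le (hineq s (hsub hs')))
  have h0t := hmono (Set.left_mem_Icc.2 ht0) (Set.right_mem_Icc.2 ht0) ht0
  have hG0 : 0 ≤ G 0 := by
    simp only [G, mul_zero, Real.cosh_zero, Real.sinh_zero]
    refine mul_nonneg (Real.exp_pos _).le ?_
    nlinarith
  have hGt := nonneg_of_mul_nonneg_right (hG0.trans h0t) (Real.exp_pos _)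
  have hp := hphi t htT₀
  have hc := Real.cosh_pos (α * t)
  rw [Real.tanh_eq_sinh_div_cosh]
  have e : -(κ * α - α ^ 2 * (Real.sinh (α * t) / Real.cosh (α * t))) /
      (α - κ * (Real.sinh (α * t) / Real.cosh (α * t))) =
      (α * (α * Real.sinh (α * t)) - κ * (α * Real.cosh (α * t))) /
      (α * Real.cosh (α * t) - κ * Real.sinh (α * t)) := by
    rw [← mul_div_mul_right _ _ hc.ne']
    congr 1 <;> field_simp
    ring
  rw [e, ge_iff_le, div_le_iff₀ hp]
  linarith
end

section
/- Let n ≥ 1 be an integer and let κ > 0, a ≥ 0 and E > 0 be real numbers. Define the sequence (εᵢ) by ε₀ = 0 and ε_{i+1} = (−E + √(E² + 2nκ² + 4a² + 2nκ·εᵢ))/2. Then (εᵢ) is monotone nondecreasing and converges, and its limit equals 𝓔 = (−F + √(F² + 8nκ² + 16a²))/4, where F = 2E − nκ. Moreover, 𝓔 is the unique nonnegative solution x of the fixed-point equation 2x + E = √(E² + 2nκ² + 4a² + 2nκx). -/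
/-- The iteration `ε₀ = 0`,
`ε_{i+1} = (-E + √(E² + 2nκ² + 4a² + 2nκ·εᵢ))/2` (with `n ≥ 1`, `κ > 0`, `a ≥ 0`,
`E > 0`) is monotone nondecreasing and converges to
`𝓔 = (-F + √(F² + 8nκ² + 16a²))/4` where `F = 2E - nκ`; moreover `𝓔` is the unique
nonnegative solution of `2x + E = √(E² + 2nκ² + 4a² + 2nκx)`. -/
theorem iteration_limit_thmA (n : ℕ) (hn : 1 ≤ n) (κ a E : ℝ)
    (hκ : 0 < κ) (ha : 0 ≤ a) (hE : 0 < E)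
    (ε : ℕ → ℝ) (hε0 : ε 0 = 0)
    (hrec : ∀ i, ε (i + 1) =
      (-E + Real.sqrt (E ^ 2 + 2 * n * κ ^ 2 + 4 * a ^ 2 + 2 * n * κ * ε i)) / 2)
    (F 𝓔 : ℝ) (hF : F = 2 * E - n * κ)
    (h𝓔 : 𝓔 = (-F + Real.sqrt (F ^ 2 + 8 * n * κ ^ 2 + 16 * a ^ 2)) / 4) :
    Monotone ε ∧
    Filter.Tendsto ε Filter.atTop (nhds 𝓔) ∧
    (0 ≤ 𝓔 ∧
      2 * 𝓔 + E = Real.sqrt (E ^ 2 + 2 * n * κ ^ 2 + 4 * a ^ 2 + 2 * n * κ * 𝓔)) ∧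
    (∀ x : ℝ, 0 ≤ x →
      2 * x + E = Real.sqrt (E ^ 2 + 2 * n * κ ^ 2 + 4 * a ^ 2 + 2 * n * κ * x) →
      x = 𝓔) := by
  have hn' : (0:ℝ) < n := by exact_mod_cast hn
  have hm : 0 < (n:ℝ) * κ := mul_pos hn' hκ
  have hC : 0 < (n:ℝ) * κ ^ 2 + 2 * a ^ 2 := by positivity
  -- the limit is the nonnegative root of the quadratic
  have hD : 0 ≤ F ^ 2 + 8 * n * κ ^ 2 + 16 * a ^ 2 := by positivity
  have hsq := Real.sq_sqrt hD
  have hFle : F ≤ Real.sqrt (F ^ 2 + 8 * n * κ ^ 2 + 16 * a ^ 2) :=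
    Real.le_sqrt_of_sq_le (by nlinarith)
  have h0 : 0 ≤ 𝓔 := by rw [h𝓔]; linarith
  have hq : 2 * 𝓔 ^ 2 + F * 𝓔 = n * κ ^ 2 + 2 * a ^ 2 := by
    have h4 : Real.sqrt (F ^ 2 + 8 * n * κ ^ 2 + 16 * a ^ 2) = 4 * 𝓔 + F := by
      rw [h𝓔]; ring
    rw [h4] at hsq
    linarith
  have hfix : 2 * 𝓔 + E =
      Real.sqrt (E ^ 2 + 2 * n * κ ^ 2 + 4 * a ^ 2 + 2 * n * κ * 𝓔) := by
    symm
    rw [Real.sqrt_eq_iff_mul_self_eq (by positivity) (by positivity)]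
    rw [hF] at hq
    linarith
  have huniq : ∀ x : ℝ, 0 ≤ x →
      2 * x + E = Real.sqrt (E ^ 2 + 2 * n * κ ^ 2 + 4 * a ^ 2 + 2 * n * κ * x) →
      x = 𝓔 := by
    intro x hx h
    have hs := Real.sq_sqrt
      (show 0 ≤ E ^ 2 + 2 * n * κ ^ 2 + 4 * a ^ 2 + 2 * n * κ * x by positivity)
    rw [← h] at hs
    have hqx : 2 * x ^ 2 + F * x = n * κ ^ 2 + 2 * a ^ 2 := by
      rw [hF]; linarith
    have hprod : (x - 𝓔) * (2 * (x + 𝓔) + F) = 0 := by linarith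
    rcases mul_eq_zero.mp hprod with h1 | h1
    · linarith
    · exfalso
      have hF2 : F = -(2 * (x + 𝓔)) := by linarith
      rw [hF2] at hqx
      have := mul_nonneg hx h0
      linarith
  -- bounds and monotonicity
  have hmono' : ∀ x y : ℝ, x ≤ y →
      (-E + Real.sqrt (E ^ 2 + 2 * n * κ ^ 2 + 4 * a ^ 2 + 2 * n * κ * x)) / 2 ≤
      (-E + Real.sqrt (E ^ 2 + 2 * n * κ ^ 2 + 4 * a ^ 2 + 2 * n * κ * y)) / 2 := by
    intro x y hxy
    gcongr
  have hmono : Monotone ε := by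
    apply monotone_nat_of_le_succ
    intro i
    induction i with
    | zero =>
      have : E ≤ Real.sqrt (E ^ 2 + 2 * n * κ ^ 2 + 4 * a ^ 2 + 2 * n * κ * ε 0) :=
        Real.le_sqrt_of_sq_le (by rw [hε0]; linarith)
      rw [hrec 0]
      linarith
    | succ k ih =>
      have := hmono' _ _ ih
      rwa [← hrec, ← hrec] at this
  have hle : ∀ i, ε i ≤ 𝓔 := by
    intro i
    induction i with
    | zero => rw [hε0]; exact h0
    | succ k ih =>
      have := hmono' _ _ ih
      rw [← hrec, ← hfix] at this
      linarith
  have hlim := tendsto_atTop_ciSup hmono ⟨𝓔, by rintro _ ⟨i, rfl⟩; exact hle i⟩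
  generalize (⨆ i, ε i) = L at hlim
  have hL0 : 0 ≤ L := by
    have := hmono.ge_of_tendsto hlim 0
    rwa [hε0] at this
  have hcont : Continuous fun x : ℝ =>
      (-E + Real.sqrt (E ^ 2 + 2 * n * κ ^ 2 + 4 * a ^ 2 + 2 * n * κ * x)) / 2 := by
    fun_prop
  have h1 := (hcont.tendsto L).comp hlim
  have h2 := hlim.comp (Filter.tendsto_add_atTop_nat 1)
  have h3 : L =
      (-E + Real.sqrt (E ^ 2 + 2 * n * κ ^ 2 + 4 * a ^ 2 + 2 * n * κ * L)) / 2 := by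
    refine tendsto_nhds_unique h2 (h1.congr fun i => ?_)
    exact (hrec i).symm
  have hLE : L = 𝓔 := huniq L hL0 (by linarith)
  rw [hLE] at hlim
  exact ⟨hmono, hlim, ⟨h0, hfix⟩, huniq⟩
end

section
/- Let a > 0, h > 0 and E > 0 be real numbers, set ε₁ = (−E + √(E² + 4a²))/2, and let κ be a real number with κ > −ε₁. Define the sequence (εᵢ)_{i≥1} by ε_{i+1} = (−E + √(E² + 4a² + 2h(κ + εᵢ)))/2. Then (εᵢ) is monotone nondecreasing and converges, and its limit equals (h − 2E + √((h − 2E)² + 8hκ + 16a²))/4. -/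
/-- With `a > 0`, `h > 0`, `E > 0`, `ε₁ = (-E + √(E² + 4a²))/2` and
`κ > -ε₁`, the iteration `ε_{i+1} = (-E + √(E² + 4a² + 2h(κ + εᵢ)))/2` (for `i ≥ 1`)
is monotone nondecreasing and converges to
`(h - 2E + √((h - 2E)² + 8hκ + 16a²))/4`. -/
theorem iteration_limit_thmF (a h E κ : ℝ) (ha : 0 < a) (hh : 0 < h) (hE : 0 < E)
    (hκ : κ > -((-E + Real.sqrt (E ^ 2 + 4 * a ^ 2)) / 2))
    (ε : ℕ → ℝ)
    (hε1 : ε 1 = (-E + Real.sqrt (E ^ 2 + 4 * a ^ 2)) / 2)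
    (hrec : ∀ i, 1 ≤ i →
      ε (i + 1) = (-E + Real.sqrt (E ^ 2 + 4 * a ^ 2 + 2 * h * (κ + ε i))) / 2) :
    (∀ i, 1 ≤ i → ε i ≤ ε (i + 1)) ∧
    Filter.Tendsto ε Filter.atTop
      (nhds ((h - 2 * E + Real.sqrt ((h - 2 * E) ^ 2 + 8 * h * κ + 16 * a ^ 2)) / 4)) := by
  set e : ℝ := (-E + Real.sqrt (E ^ 2 + 4 * a ^ 2)) / 2 with he
  set D : ℝ := Real.sqrt ((h - 2 * E) ^ 2 + 8 * h * κ + 16 * a ^ 2) with hD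
  set L : ℝ := (h - 2 * E + D) / 4 with hL
  have hse : Real.sqrt (E ^ 2 + 4 * a ^ 2) = 2 * e + E := by rw [he]; ring
  have hs0 : 0 ≤ 2 * e + E := hse ▸ Real.sqrt_nonneg _
  have hs2 : (2 * e + E) ^ 2 = E ^ 2 + 4 * a ^ 2 := by
    rw [← hse]; exact Real.sq_sqrt (by positivity)
  have hpos : 0 < h * (κ + e) := mul_pos hh (by linarith)
  have hlt : (4 * e - (h - 2 * E)) ^ 2 < (h - 2 * E) ^ 2 + 8 * h * κ + 16 * a ^ 2 := by
    nlinarith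
  have habs : |4 * e - (h - 2 * E)| < D := by
    rw [hD, ← Real.sqrt_sq_eq_abs]; exact Real.sqrt_lt_sqrt (sq_nonneg _) hlt
  obtain ⟨h1, h2⟩ := abs_lt.mp habs
  have hD2 : D ^ 2 = (h - 2 * E) ^ 2 + 8 * h * κ + 16 * a ^ 2 :=
    Real.sq_sqrt (le_trans (sq_nonneg _) hlt.le)
  have hDL : D = 4 * L - (h - 2 * E) := by rw [hL]; ring
  have heL : e < L := by linarith
  have hLq : (2 * L + E) ^ 2 = E ^ 2 + 4 * a ^ 2 + 2 * h * (κ + L) := by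
    rw [hDL] at hD2; nlinarith
  have hfL : Real.sqrt (E ^ 2 + 4 * a ^ 2 + 2 * h * (κ + L)) = 2 * L + E := by
    rw [← hLq]; exact Real.sqrt_sq (by linarith)
  have hmono : ∀ x y : ℝ, x ≤ y → Real.sqrt (E ^ 2 + 4 * a ^ 2 + 2 * h * (κ + x)) ≤
      Real.sqrt (E ^ 2 + 4 * a ^ 2 + 2 * h * (κ + y)) := by
    intro x y hxy
    apply Real.sqrt_le_sqrt
    nlinarith
  have hinv : ∀ i, 1 ≤ i → e ≤ ε i ∧ ε i ≤ L ∧ ε i ≤ ε (i + 1) := by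
    intro i hi
    induction i, hi using Nat.le_induction with
    | base =>
      refine ⟨hε1.ge, hε1 ▸ heL.le, ?_⟩
      rw [hrec 1 le_rfl, hε1]
      have : Real.sqrt (E ^ 2 + 4 * a ^ 2) ≤
          Real.sqrt (E ^ 2 + 4 * a ^ 2 + 2 * h * (κ + e)) :=
        Real.sqrt_le_sqrt (by nlinarith)
      linarith
    | succ n hn ih =>
      obtain ⟨i1, i2, i3⟩ := ih
      refine ⟨i1.trans i3, ?_, ?_⟩
      · have := hmono _ _ i2
        rw [hrec n hn]; linarith
      · have := hmono _ _ i3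
        rw [hrec (n + 1) (by omega)]
        have h3 := hrec n hn
        linarith
  refine ⟨fun i hi => (hinv i hi).2.2, ?_⟩
  have hm : Monotone (fun n => ε (n + 1)) :=
    monotone_nat_of_le_succ fun n => (hinv (n + 1) (by omega)).2.2
  have hb : BddAbove (Set.range (fun n => ε (n + 1))) :=
    ⟨L, by rintro _ ⟨n, rfl⟩; exact (hinv (n + 1) (by omega)).2.1⟩
  obtain ⟨M, hM⟩ : ∃ M, Filter.Tendsto (fun n => ε (n + 1)) Filter.atTop (nhds M) :=
    ⟨_, tendsto_atTop_ciSup hm hb⟩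
  have hMe : e ≤ M := ge_of_tendsto' hM fun n => (hinv (n + 1) (by omega)).1
  have hM' := (Filter.tendsto_add_atTop_iff_nat 1).mpr hM
  have hc : Continuous (fun x : ℝ =>
      (-E + Real.sqrt (E ^ 2 + 4 * a ^ 2 + 2 * h * (κ + x))) / 2) := by fun_prop
  have hM2 := (hc.tendsto M).comp hM
  have hfM : M = (-E + Real.sqrt (E ^ 2 + 4 * a ^ 2 + 2 * h * (κ + M))) / 2 := by
    refine tendsto_nhds_unique hM' (hM2.congr fun n => ?_)
    exact (hrec (n + 1) (by omega)).symm
  have hMq : (2 * M + E) ^ 2 = E ^ 2 + 4 * a ^ 2 + 2 * h * (κ + M) := by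
    have h3 : 2 * M + E = Real.sqrt (E ^ 2 + 4 * a ^ 2 + 2 * h * (κ + M)) := by linarith
    rw [h3]
    exact Real.sq_sqrt (by nlinarith [sq_nonneg E, sq_nonneg a, mul_nonneg hh.le (sub_nonneg.mpr hMe)])
  have hprod : (M - L) * (2 * M + 2 * L + 2 * E - h) = 0 := by nlinarith
  have hML : M = L := by
    rcases mul_eq_zero.mp hprod with h3 | h3
    · linarith
    · linarith
  rw [← hML]
  exact (Filter.tendsto_add_atTop_iff_nat 1).mp hM
end
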